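/- arXiv:2509.15199 — 3 statements merged into one kernel-verified Lean document; each statement's English description precedes it below -/
import Mathlib

section
/- Let P be a full-support joint distribution on Ω, fix a linear order on ι and a parent assignment (Π_i)_{i∈ι}, and let Q be the Bayesian projection of P with respect to (Π_i). Then the Kullback–Leibler divergence from P to Q satisfies the identity D_KL(P ‖ Q) = − Σ_{i ∈ ι} I({i} ; Π_i) + Σ_{i ∈ ι} H({i}) − H(ι), where I({i} ; ∅) = 0 by convention. Consequently, minimizing D_KL(P ‖ Q) over parent assignments is equivalent to maximizing Σ_{i ∈ ι} I({i} ; Π_i). -/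
open scoped BigOperators

namespace CausalPre

variable {ι : Type*} [Fintype ι] [DecidableEq ι]
variable {F : ι → Type*} [∀ i, Fintype (F i)] [∀ i, DecidableEq (F i)]
  [∀ i, Nonempty (F i)]

/-- Restriction of a full configuration to the coordinates in `S`. -/
def restrict (S : Finset ι) (x : ∀ i, F i) : ∀ i : S, F i := fun i => x i

/-- `P` is a joint distribution on `Ω = Π i, F i`. -/
def IsJoint (P : (∀ i, F i) → ℝ) : Prop :=
  (∀ x, 0 ≤ P x) ∧ ∑ x, P x = 1

/-- `P` has full support. -/
def FullSupport (P : (∀ i, F i) → ℝ) : Prop := ∀ x, 0 < P x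

/-- Marginal of `P` on the coordinates in `S`. -/
noncomputable def marginal (P : (∀ i, F i) → ℝ) (S : Finset ι)
    (s : ∀ i : S, F i) : ℝ :=
  ∑ x : ∀ i, F i, if restrict S x = s then P x else 0

/-- Conditional probability `P[T | S]`, evaluated at the restrictions of a full
configuration `x`:  `P[T | S](x_T | x_S) = P_{S ∪ T}(x_{S ∪ T}) / P_S(x_S)`. -/
noncomputable def condProb (P : (∀ i, F i) → ℝ) (T S : Finset ι)
    (x : ∀ i, F i) : ℝ :=
  marginal P (S ∪ T) (restrict (S ∪ T) x) / marginal P S (restrict S x)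

/-- Entropy of the marginal of `P` on `S`. -/
noncomputable def entropy (P : (∀ i, F i) → ℝ) (S : Finset ι) : ℝ :=
  -∑ s : ∀ i : S, F i, marginal P S s * Real.log (marginal P S s)

/-- Mutual information `I(S ; T)` of disjoint `S`, `T`. -/
noncomputable def mutualInfo (P : (∀ i, F i) → ℝ) (S T : Finset ι) : ℝ :=
  entropy P S + entropy P T - entropy P (S ∪ T)

/-- Conditional entropy `H(S | T)` for disjoint `S`, `T`. -/
noncomputable def condEntropy (P : (∀ i, F i) → ℝ) (S T : Finset ι) : ℝ :=
  entropy P (S ∪ T) - entropy P T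

/-- Conditional mutual information `I(S ; T | U)` of pairwise disjoint `S`, `T`, `U`. -/
noncomputable def condMutualInfo (P : (∀ i, F i) → ℝ) (S T U : Finset ι) : ℝ :=
  entropy P (S ∪ U) + entropy P (T ∪ U) - entropy P (S ∪ T ∪ U) - entropy P U

/-- Kullback–Leibler divergence `D_KL(P ‖ Q) = Σ_{x : P(x) > 0} P(x) log (P(x)/Q(x))`. -/
noncomputable def klDiv (P Q : (∀ i, F i) → ℝ) : ℝ :=
  ∑ x, if 0 < P x then P x * Real.log (P x / Q x) else 0

variable [LinearOrder ι]

/-- A parent assignment with respect to a linear order: `Pa i ⊆ {j : j < i}`. -/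
def IsParentAssignment (Pa : ι → Finset ι) : Prop :=
  ∀ i, ∀ j ∈ Pa i, j < i

/-- Bayesian projection of `P` with respect to a parent assignment:
`Q(x) = Π_i P[{i} | Pa i](x_i | x_{Pa i})`. -/
noncomputable def bayesProj (P : (∀ i, F i) → ℝ) (Pa : ι → Finset ι)
    (x : ∀ i, F i) : ℝ :=
  ∏ i, condProb P {i} (Pa i) x

theorem marginal_restrict_pos {P : (∀ i, F i) → ℝ} (hfull : FullSupport P) (S : Finset ι)
    (x : ∀ i, F i) : 0 < marginal P S (restrict S x) := by
  refine Finset.sum_pos' (fun y _ => ?_) ⟨x, Finset.mem_univ x, ?_⟩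
  · split_ifs
    exacts [(hfull y).le, le_rfl]
  · simpa using hfull x

theorem sum_marginal_mul (P : (∀ i, F i) → ℝ) (S : Finset ι) (g : (∀ i : S, F i) → ℝ) :
    ∑ s, marginal P S s * g s = ∑ x, P x * g (restrict S x) := by
  simp only [marginal, Finset.sum_mul]
  rw [Finset.sum_comm]
  simp [ite_mul]

theorem marginal_univ_restrict (P : (∀ i, F i) → ℝ) (x : ∀ i, F i) :
    marginal P Finset.univ (restrict Finset.univ x) = P x := by
  have h (y : ∀ i, F i) :
      restrict Finset.univ y = restrict Finset.univ x ↔ y = x :=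
    ⟨fun h => funext fun i => congrFun h ⟨i, Finset.mem_univ i⟩, fun h => h ▸ rfl⟩
  simp [marginal, h]

theorem entropy_eq_sum (P : (∀ i, F i) → ℝ) (S : Finset ι) :
    entropy P S = -∑ x, P x * Real.log (marginal P S (restrict S x)) := by
  rw [entropy, sum_marginal_mul P S fun s => Real.log (marginal P S s)]

theorem entropy_univ (P : (∀ i, F i) → ℝ) :
    entropy P Finset.univ = -∑ x, P x * Real.log (P x) := by
  simp only [entropy_eq_sum, marginal_univ_restrict]

theorem condProb_pos {P : (∀ i, F i) → ℝ} (hfull : FullSupport P) (T S : Finset ι)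
    (x : ∀ i, F i) : 0 < condProb P T S x :=
  div_pos (marginal_restrict_pos hfull _ x) (marginal_restrict_pos hfull _ x)

theorem sum_mul_log_condProb {P : (∀ i, F i) → ℝ} (hfull : FullSupport P) (T S : Finset ι) :
    ∑ x, P x * Real.log (condProb P T S x) = mutualInfo P T S - entropy P T := by
  have h (x : ∀ i, F i) : P x * Real.log (condProb P T S x) =
      P x * Real.log (marginal P (T ∪ S) (restrict (T ∪ S) x)) -
        P x * Real.log (marginal P S (restrict S x)) := by
    rw [condProb, Finset.union_comm S T,
      Real.log_div (marginal_restrict_pos hfull _ x).ne' (marginal_restrict_pos hfull _ x).ne',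
      mul_sub]
  simp only [h, Finset.sum_sub_distrib, mutualInfo, entropy_eq_sum]
  ring

theorem klDiv_bayesProj {P : (∀ i, F i) → ℝ} (hfull : FullSupport P) (Pa : ι → Finset ι) :
    klDiv P (bayesProj P Pa)
      = -(∑ i, mutualInfo P {i} (Pa i)) + (∑ i, entropy P {i}) - entropy P Finset.univ := by
  have h (x : ∀ i, F i) :
      (if 0 < P x then P x * Real.log (P x / bayesProj P Pa x) else 0) =
        P x * Real.log (P x) - ∑ i, P x * Real.log (condProb P {i} (Pa i) x) := by
    have hne (i : ι) : condProb P {i} (Pa i) x ≠ 0 := (condProb_pos hfull _ _ x).ne'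
    rw [if_pos (hfull x), bayesProj,
      Real.log_div (hfull x).ne' (Finset.prod_ne_zero_iff.2 fun i _ => hne i),
      Real.log_prod fun i _ => hne i, mul_sub, Finset.mul_sum]
  simp only [klDiv, h, Finset.sum_sub_distrib]
  rw [Finset.sum_comm]
  simp only [sum_mul_log_condProb hfull, Finset.sum_sub_distrib, entropy_univ]
  ring

/-- For a full-support joint distribution `P` and a parent
assignment `Pa` with Bayesian projection `Q`,
`D_KL(P ‖ Q) = − Σ_i I({i} ; Pa i) + Σ_i H({i}) − H(ι)`
(here `I({i} ; ∅) = 0` holds automatically for a joint distribution).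
Consequently, minimizing `D_KL(P ‖ Q)` over parent assignments is equivalent to
maximizing `Σ_i I({i} ; Pa i)`. -/
theorem klDiv_bayesProj_eq_and_minimization_equiv
    (P : (∀ i, F i) → ℝ) (hP : IsJoint P) (hfull : FullSupport P)
    (Pa : ι → Finset ι) (hPa : IsParentAssignment Pa) :
    klDiv P (bayesProj P Pa)
        = -(∑ i, mutualInfo P {i} (Pa i)) + (∑ i, entropy P {i})
            - entropy P Finset.univ
      ∧ ∀ Pa' : ι → Finset ι, IsParentAssignment Pa' →
          (klDiv P (bayesProj P Pa) ≤ klDiv P (bayesProj P Pa') ↔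
            ∑ i, mutualInfo P {i} (Pa' i) ≤ ∑ i, mutualInfo P {i} (Pa i)) := by
  refine ⟨klDiv_bayesProj hfull Pa, fun Pa' _ => ?_⟩
  rw [klDiv_bayesProj hfull Pa, klDiv_bayesProj hfull Pa']
  constructor <;> intro h <;> linarith

end CausalPre
end

section
/- Let (U, 𝒮, q) be an X3C instance. (i) Every subset C ⊆ U with |C| ≤ 3 has reduction weight W(C) ≤ 3. (ii) If C_1, …, C_q are pairwise disjoint subsets of U, each of cardinality at most 3, whose union is U, and whose total weight Σ_{i=1}^{q} W(C_i) is at least 3q, then every C_i has cardinality exactly 3, W(C_i) = 3 for every i, and every 2-element subset of each C_i is contained in some member of 𝒮. -/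
open scoped BigOperators

namespace CausalPre

variable {α : Type*} [DecidableEq α]

/-- Reduction weight of a subset `C`: the number of unordered pairs `{u, v}` of
distinct elements of `C` (i.e. 2-element subsets of `C`) that are contained in
some member of `𝒮`.  Equivalently, `W(C) = Σ_{{u,v} ⊆ C, u ≠ v} w(u, v)` where
`w(u, v) = 1` if `{u, v} ⊆ S` for some `S ∈ 𝒮` and `w(u, v) = 0` otherwise. -/
def cliqueWeight (𝒮 : Finset (Finset α)) (C : Finset α) : ℕ :=
  ∑ p ∈ C.powersetCard 2, if ∃ S ∈ 𝒮, p ⊆ S then 1 else 0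

/-- `𝒮'` is an exact cover for the X3C instance `(U, 𝒮, q)`: a subfamily of `𝒮`
of cardinality `q` whose members are pairwise disjoint and whose union is `U`. -/
def IsExactCover (U : Finset α) (𝒮 : Finset (Finset α)) (q : ℕ)
    (𝒮' : Finset (Finset α)) : Prop :=
  𝒮' ⊆ 𝒮 ∧ 𝒮'.card = q ∧
    (∀ S ∈ 𝒮', ∀ T ∈ 𝒮', S ≠ T → Disjoint S T) ∧
    𝒮'.sup id = U

theorem cliqueWeight_eq_card_filter (𝒮 : Finset (Finset α)) (C : Finset α) :
    cliqueWeight 𝒮 C = ((C.powersetCard 2).filter fun p => ∃ S ∈ 𝒮, p ⊆ S).card := by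
  rw [cliqueWeight, Finset.card_filter]

theorem cliqueWeight_le_choose (𝒮 : Finset (Finset α)) (C : Finset α) :
    cliqueWeight 𝒮 C ≤ C.card.choose 2 := by
  rw [cliqueWeight_eq_card_filter, ← Finset.card_powersetCard]
  exact Finset.card_filter_le _ _

theorem cliqueWeight_le_three (𝒮 : Finset (Finset α)) {C : Finset α} (hC : C.card ≤ 3) :
    cliqueWeight 𝒮 C ≤ 3 :=
  (cliqueWeight_le_choose 𝒮 C).trans (Nat.choose_le_choose 2 hC)

theorem card_eq_three_of_cliqueWeight_eq_three {𝒮 : Finset (Finset α)} {C : Finset α}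
    (hC : C.card ≤ 3) (hW : cliqueWeight 𝒮 C = 3) : C.card = 3 := by
  by_contra hne
  have hlt : C.card ≤ 2 := by omega
  have hle : C.card.choose 2 ≤ 1 := Nat.choose_le_choose 2 hlt
  have := cliqueWeight_le_choose 𝒮 C
  omega

theorem exists_superset_of_cliqueWeight_eq_choose {𝒮 : Finset (Finset α)} {C : Finset α}
    (hW : cliqueWeight 𝒮 C = C.card.choose 2) :
    ∀ p ∈ C.powersetCard 2, ∃ S ∈ 𝒮, p ⊆ S := by
  rw [cliqueWeight_eq_card_filter, ← Finset.card_powersetCard] at hW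
  exact Finset.card_filter_eq_iff.mp hW

/-- For an X3C instance `(U, 𝒮, q)`:
(i) every `C ⊆ U` with `|C| ≤ 3` has reduction weight `W(C) ≤ 3`; and
(ii) if `C_1, …, C_q` are pairwise disjoint subsets of `U`, each of cardinality
at most `3`, whose union is `U` and whose total weight is at least `3q`, then
every `C_i` has cardinality exactly `3`, `W(C_i) = 3`, and every 2-element
subset of each `C_i` is contained in some member of `𝒮`. -/
theorem weight_le_three_and_tight_partition
    (U : Finset α) (q : ℕ) (hq : 1 ≤ q) (hU : U.card = 3 * q)
    (𝒮 : Finset (Finset α)) (h𝒮 : ∀ S ∈ 𝒮, S ⊆ U ∧ S.card = 3) :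
    (∀ C : Finset α, C ⊆ U → C.card ≤ 3 → cliqueWeight 𝒮 C ≤ 3)
      ∧ ∀ C : Fin q → Finset α,
          (∀ i, C i ⊆ U) →
          (∀ i j, i ≠ j → Disjoint (C i) (C j)) →
          (∀ i, (C i).card ≤ 3) →
          Finset.univ.biUnion C = U →
          3 * q ≤ ∑ i, cliqueWeight 𝒮 (C i) →
          ∀ i, (C i).card = 3 ∧ cliqueWeight 𝒮 (C i) = 3
            ∧ ∀ p ∈ (C i).powersetCard 2, ∃ S ∈ 𝒮, p ⊆ S := by
  refine ⟨fun C _ hC => cliqueWeight_le_three 𝒮 hC, fun C _ _ hcard _ hsum i => ?_⟩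
  have hle : ∀ j ∈ Finset.univ, cliqueWeight 𝒮 (C j) ≤ 3 :=
    fun j _ => cliqueWeight_le_three 𝒮 (hcard j)
  have hconst : ∑ _j : Fin q, 3 = 3 * q := by simp [mul_comm]
  have hW : cliqueWeight 𝒮 (C i) = 3 :=
    (Finset.sum_eq_sum_iff_of_le hle).mp
      (le_antisymm (Finset.sum_le_sum hle) (hconst.trans_le hsum)) i (Finset.mem_univ i)
  have hC : (C i).card = 3 := card_eq_three_of_cliqueWeight_eq_three (hcard i) hW
  refine ⟨hC, hW, exists_superset_of_cliqueWeight_eq_choose ?_⟩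
  rw [hW, hC]
  rfl

end CausalPre
end

section
/- Let P be a full-support joint distribution on Ω and let C_1, …, C_r, F_i, R_i, Q be as in the chain junction construction. Then for every i with 1 ≤ i ≤ r, the marginal of Q on the clique C_i equals the marginal of P on C_i: Q_{C_i} = P_{C_i}. That is, the low-dimensional marginal-based factorization exactly preserves every clique marginal of the original distribution. -/
open scoped BigOperators

namespace CausalPre

variable {ι : Type*} [Fintype ι] [DecidableEq ι]
variable {F : ι → Type*} [∀ i, Fintype (F i)] [∀ i, DecidableEq (F i)]
  [∀ i, Nonempty (F i)]

variable {r : ℕ}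

/-- Union of the preceding cliques: `C_0 ∪ … ∪ C_{i-1}`. -/
def prevUnion (C : Fin (r + 1) → Finset ι) (i : Fin (r + 1)) : Finset ι :=
  (Finset.univ.filter (fun j => j < i)).sup C

/-- Separator `F_i = C_i ∩ (C_0 ∪ … ∪ C_{i-1})`. -/
def sepSet (C : Fin (r + 1) → Finset ι) (i : Fin (r + 1)) : Finset ι :=
  C i ∩ prevUnion C i

/-- Residual `R_i = C_i \ F_i`. -/
def resSet (C : Fin (r + 1) → Finset ι) (i : Fin (r + 1)) : Finset ι :=
  C i \ sepSet C i

/-- The chain junction factorization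
`Q(x) = P_{C_0}(x_{C_0}) · Π_{i ≠ 0} P[R_i | F_i](x_{R_i} | x_{F_i})`. -/
noncomputable def chainQ (P : (∀ i, F i) → ℝ) (C : Fin (r + 1) → Finset ι)
    (x : ∀ i, F i) : ℝ :=
  marginal P (C 0) (restrict (C 0) x) *
    ∏ i ∈ Finset.univ.filter (fun j : Fin (r + 1) => j ≠ 0),
      condProb P (resSet C i) (sepSet C i) x

set_option linter.unusedSectionVars false

/-- The average of `f` over all coordinates outside `S`, as a function of the full configuration. -/
noncomputable def avg (S : Finset ι) (f : (∀ i, F i) → ℝ) (x : ∀ i, F i) : ℝ :=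
  (∑ y, f (S.piecewise x y)) / Fintype.card (∀ i, F i)

theorem dependsOn_avg (S : Finset ι) (f : (∀ i, F i) → ℝ) : DependsOn (avg S f) S := by
  intro x y h
  unfold avg
  congr! 3 with z
  exact Finset.piecewise_congr _ h fun _ _ => rfl

theorem avg_mul_of_dependsOn {S : Finset ι} {g : (∀ i, F i) → ℝ} (hg : DependsOn g S)
    (f : (∀ i, F i) → ℝ) : avg S (fun x => g x * f x) = fun x => g x * avg S f x := by
  funext x
  have h (y : ∀ i, F i) : g (S.piecewise x y) = g x :=
    hg fun i hi => Finset.piecewise_eq_of_mem _ _ _ hi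
  simp only [avg, h, ← Finset.mul_sum, mul_div_assoc]

theorem avg_eq_self_of_dependsOn {S : Finset ι} {g : (∀ i, F i) → ℝ} (hg : DependsOn g S) :
    avg S g = g := by
  funext x
  have h (y : ∀ i, F i) : g (S.piecewise x y) = g x :=
    hg fun i hi => Finset.piecewise_eq_of_mem _ _ _ hi
  have hc : (Fintype.card (∀ i, F i) : ℝ) ≠ 0 := Nat.cast_ne_zero.2 Fintype.card_ne_zero
  simp only [avg, h, Finset.sum_const, Finset.card_univ, nsmul_eq_mul]
  field_simp

/-- Averaging operators compose by intersecting the sets of coordinates they keep. -/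
theorem avg_avg (S T : Finset ι) (f : (∀ i, F i) → ℝ) : avg S (avg T f) = avg (S ∩ T) f := by
  funext x
  have hc : (Fintype.card (∀ i, F i) : ℝ) ≠ 0 := Nat.cast_ne_zero.2 Fintype.card_ne_zero
  let e : (∀ i, F i) × (∀ i, F i) → (∀ i, F i) × (∀ i, F i) :=
    fun p => (T.piecewise p.1 p.2, T.piecewise p.2 p.1)
  have he : Function.Involutive e := by
    rintro ⟨y, z⟩
    ext i <;> by_cases hi : i ∈ T <;> simp [e, hi]
  have key : ∑ y, ∑ z, f (T.piecewise (S.piecewise x y) z) =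
      ∑ y : ∀ i, F i, ∑ _z : ∀ i, F i, f ((S ∩ T).piecewise x y) := by
    rw [← Fintype.sum_prod_type', ← Fintype.sum_prod_type']
    refine Fintype.sum_bijective e he.bijective _ _ fun p => congrArg f ?_
    ext i
    by_cases hS : i ∈ S <;> by_cases hT : i ∈ T <;> simp [e, Finset.piecewise, hS, hT]
  simp only [Finset.sum_const, Finset.card_univ, nsmul_eq_mul, ← Finset.mul_sum] at key
  simp only [avg, ← Finset.sum_div, key]
  field_simp

theorem avg_pos {f : (∀ i, F i) → ℝ} (hf : FullSupport f) (S : Finset ι) (x : ∀ i, F i) :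
    0 < avg S f x :=
  div_pos (Finset.sum_pos (fun _ _ => hf _) Finset.univ_nonempty)
    (Nat.cast_pos.2 Fintype.card_pos)

/-- The number of configurations agreeing with a given one on `S`. -/
def fiberCard (F : ι → Type*) [∀ i, Fintype (F i)] (S : Finset ι) : ℝ :=
  ∏ i ∈ Sᶜ, (Fintype.card (F i) : ℝ)

theorem fiberCard_pos (S : Finset ι) : 0 < fiberCard F S :=
  Finset.prod_pos fun _ _ => Nat.cast_pos.2 Fintype.card_pos

theorem fiberCard_univ : fiberCard F (Finset.univ : Finset ι) = 1 := by simp [fiberCard]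

theorem fiberCard_union_mul_inter (S T : Finset ι) :
    fiberCard F (S ∪ T) * fiberCard F (S ∩ T) = fiberCard F S * fiberCard F T := by
  simp only [fiberCard, Finset.compl_union, Finset.compl_inter]
  rw [mul_comm, Finset.prod_union_inter]

theorem marginal_restrict (f : (∀ i, F i) → ℝ) (S : Finset ι) (x : ∀ i, F i) :
    marginal f S (restrict S x) = fiberCard F S * avg S f x := by
  have hcount (w : ∀ i, F i) (hw : restrict S w = restrict S x) :
      ((Finset.univ.filter fun y => S.piecewise x y = w).card : ℝ) =
        ∏ i ∈ S, (Fintype.card (F i) : ℝ) := by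
    have hset : (Finset.univ.filter fun y => S.piecewise x y = w) =
        Fintype.piFinset fun i => if i ∈ S then Finset.univ else {w i} := by
      ext y
      simp only [Finset.mem_filter, Finset.mem_univ, true_and, Fintype.mem_piFinset, funext_iff]
      refine forall_congr' fun i => ?_
      by_cases hi : i ∈ S
      · simpa [hi, restrict] using (congrFun hw ⟨i, hi⟩).symm
      · simp [hi]
    rw [hset, Fintype.card_piFinset]
    push_cast
    rw [← Finset.prod_subset (Finset.subset_univ S) (fun i _ hi => by simp [hi])]
    exact Finset.prod_congr rfl fun i hi => by simp [hi]
  have hsum : ∑ y, f (S.piecewise x y) =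
      (∏ i ∈ S, (Fintype.card (F i) : ℝ)) * marginal f S (restrict S x) := by
    rw [marginal, Finset.mul_sum, ← Finset.sum_fiberwise Finset.univ (fun y => S.piecewise x y)]
    refine Finset.sum_congr rfl fun w _ => ?_
    rw [Finset.sum_congr rfl (g := fun _ => f w) fun y hy => by rw [(Finset.mem_filter.1 hy).2],
      Finset.sum_const, nsmul_eq_mul]
    split_ifs with hw
    · rw [hcount w hw]
    · rw [Finset.filter_eq_empty_iff.2]
      · simp
      · rintro y - rfl
        exact hw (funext fun i => Finset.piecewise_eq_of_mem _ _ _ i.2)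
  have hcard : (Fintype.card (∀ i, F i) : ℝ) =
      (∏ i ∈ S, (Fintype.card (F i) : ℝ)) * fiberCard F S := by
    rw [fiberCard, Finset.prod_mul_prod_compl, Fintype.card_pi]
    push_cast
    rfl
  have hS : (∏ i ∈ S, (Fintype.card (F i) : ℝ)) ≠ 0 :=
    Finset.prod_ne_zero_iff.2 fun _ _ => Nat.cast_ne_zero.2 Fintype.card_ne_zero
  have hN : fiberCard F S ≠ 0 := (fiberCard_pos S).ne'
  rw [avg, hsum, hcard]
  field_simp

/-- The chain factorization along a sequence of cliques, with averages in place of marginals. -/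
noncomputable def avgChain (P : (∀ i, F i) → ℝ) (C : ℕ → Finset ι) (k : ℕ) (x : ∀ i, F i) : ℝ :=
  avg (C 0) P x * ∏ i ∈ Finset.range k,
    (avg (C (i + 1)) P x / avg (C (i + 1) ∩ (Finset.range (i + 1)).sup C) P x)

theorem dependsOn_avgChain (P : (∀ i, F i) → ℝ) (C : ℕ → Finset ι) (k : ℕ) :
    DependsOn (avgChain P C k) ((Finset.range (k + 1)).sup C : Finset ι) := by
  have hle {i : ℕ} (hi : i ≤ k) : C i ⊆ (Finset.range (k + 1)).sup C :=
    Finset.le_sup (f := C) (Finset.mem_range.2 (Nat.lt_succ_of_le hi))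
  intro x y h
  have havg {S : Finset ι} (hS : S ⊆ (Finset.range (k + 1)).sup C) : avg S P x = avg S P y :=
    dependsOn_avg S P fun i hi => h i (hS hi)
  unfold avgChain
  rw [havg (hle k.zero_le)]
  congr 1
  refine Finset.prod_congr rfl fun i hi => ?_
  have hi := hle (Finset.mem_range.1 hi)
  rw [havg hi, havg (Finset.inter_subset_left.trans hi)]

theorem avg_avgChain {P : (∀ i, F i) → ℝ} (hP : FullSupport P) (C : ℕ → Finset ι) (k : ℕ)
    (hsep : ∀ i < k, C (i + 1) ∩ (Finset.range (i + 1)).sup C ⊆ C i) :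
    ∀ j ≤ k, avg (C j) (avgChain P C k) = avg (C j) P := by
  induction k with
  | zero =>
    rintro j hj
    obtain rfl := Nat.le_zero.1 hj
    have h : avgChain P C 0 = avg (C 0) P := by funext x; simp [avgChain]
    rw [h, avg_avg, Finset.inter_self]
  | succ k ih =>
    have ih := ih fun i hi => hsep i (hi.trans k.lt_succ_self)
    set U := (Finset.range (k + 1)).sup C with hU
    have hq : DependsOn (avgChain P C k) U := dependsOn_avgChain P C k
    have ha : DependsOn (avg (C (k + 1) ∩ U) P) (C (k + 1) ∩ U : Finset ι) := dependsOn_avg _ _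
    have hpos (x) : avg (C (k + 1) ∩ U) P x ≠ 0 := (avg_pos hP _ x).ne'
    have hstep (x) : avgChain P C (k + 1) x =
        avgChain P C k x * (avg (C (k + 1)) P x / avg (C (k + 1) ∩ U) P x) := by
      simp only [avgChain, Finset.prod_range_succ, mul_assoc, hU]
    intro j hj
    rcases Nat.le_succ_iff.1 hj with hj | rfl
    · have hjU : C j ⊆ U := Finset.le_sup (f := C) (Finset.mem_range.2 (Nat.lt_succ_of_le hj))
      have hU' : avg U (avgChain P C (k + 1)) = avgChain P C k := by
        have hg : DependsOn (fun x => avgChain P C k x / avg (C (k + 1) ∩ U) P x) U := by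
          intro x y h
          simp only [hq h, ha fun i hi => h i (Finset.inter_subset_right hi)]
        have hfun : avgChain P C (k + 1) = fun x =>
            (avgChain P C k x / avg (C (k + 1) ∩ U) P x) * avg (C (k + 1)) P x := by
          funext x
          rw [hstep]
          ring
        rw [hfun, avg_mul_of_dependsOn hg, avg_avg, Finset.inter_comm U]
        exact funext fun x => div_mul_cancel₀ _ (hpos x)
      rw [← Finset.inter_eq_left.2 hjU, ← avg_avg, hU', Finset.inter_eq_left.2 hjU, ih j hj]
    · have hg : DependsOn (fun x => avg (C (k + 1)) P x / avg (C (k + 1) ∩ U) P x)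
          (C (k + 1)) := by
        intro x y h
        simp only [dependsOn_avg _ P h, ha fun i hi => h i (Finset.inter_subset_left hi)]
      have hfun : avgChain P C (k + 1) = fun x =>
          (avg (C (k + 1)) P x / avg (C (k + 1) ∩ U) P x) * avgChain P C k x := by
        funext x
        rw [hstep, mul_comm]
      have hF : avg (C (k + 1)) (avgChain P C k) = avg (C (k + 1) ∩ U) P := by
        have hsub := Finset.inter_eq_left.2 (hsep k k.lt_succ_self)
        rw [← avg_eq_self_of_dependsOn hq, avg_avg, ← hsub, ← avg_avg, ih k le_rfl, avg_avg]
      rw [hfun, avg_mul_of_dependsOn hg, hF]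
      exact funext fun x => div_mul_cancel₀ _ (hpos x)

theorem fiberCard_sup_range (C : ℕ → Finset ι) (k : ℕ) :
    fiberCard F (C 0) * ∏ i ∈ Finset.range k, (fiberCard F (C (i + 1)) /
      fiberCard F (C (i + 1) ∩ (Finset.range (i + 1)).sup C)) =
    fiberCard F ((Finset.range (k + 1)).sup C) := by
  induction k with
  | zero => simp
  | succ k ih =>
    have h := fiberCard_union_mul_inter (F := F) (C (k + 1)) ((Finset.range (k + 1)).sup C)
    rw [Finset.prod_range_succ, ← mul_assoc, ih, Finset.range_add_one (n := k + 1),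
      Finset.sup_insert, Finset.sup_eq_union, ← mul_div_assoc,
      div_eq_iff (fiberCard_pos _).ne', h, mul_comm]

theorem condProb_resSet_sepSet (P : (∀ i, F i) → ℝ) (C : Fin (r + 1) → Finset ι)
    (i : Fin (r + 1)) (x : ∀ i, F i) :
    condProb P (resSet C i) (sepSet C i) x =
      fiberCard F (C i) / fiberCard F (sepSet C i) * (avg (C i) P x / avg (sepSet C i) P x) := by
  have h : sepSet C i ∪ resSet C i = C i :=
    Finset.union_sdiff_of_subset Finset.inter_subset_left
  rw [condProb, h, marginal_restrict, marginal_restrict, mul_div_mul_comm]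

theorem prevUnion_eq_sup_range (C : ℕ → Finset ι) (i : Fin (r + 1)) :
    prevUnion (fun j : Fin (r + 1) => C j) i = (Finset.range i).sup C := by
  ext a
  simp only [prevUnion, Finset.mem_sup, Finset.mem_filter, Finset.mem_univ, true_and,
    Finset.mem_range]
  exact ⟨fun ⟨j, hj, ha⟩ => ⟨j, hj, ha⟩, fun ⟨j, hj, ha⟩ => ⟨⟨j, hj.trans i.2⟩, hj, ha⟩⟩

theorem chainQ_eq_avgChain (P : (∀ i, F i) → ℝ) (C : ℕ → Finset ι)
    (hcov : (Finset.range (r + 1)).sup C = Finset.univ) :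
    chainQ P (fun j : Fin (r + 1) => C j) = avgChain P C r := by
  funext x
  have hconst := fiberCard_sup_range (F := F) C r
  rw [hcov, fiberCard_univ] at hconst
  have hfilter : (Finset.univ.filter fun j : Fin (r + 1) => j ≠ 0) =
      Finset.univ.map (Fin.succEmb r) := by
    ext j
    simp [Fin.exists_succ_eq]
  rw [chainQ, hfilter, Finset.prod_map, marginal_restrict]
  simp only [condProb_resSet_sepSet]
  simp only [sepSet, prevUnion_eq_sup_range, Fin.coe_succEmb,
    Fin.val_succ, Fin.val_zero]
  rw [Fin.prod_univ_eq_prod_range (fun i => fiberCard F (C (i + 1)) /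
      fiberCard F (C (i + 1) ∩ (Finset.range (i + 1)).sup C) *
        (avg (C (i + 1)) P x / avg (C (i + 1) ∩ (Finset.range (i + 1)).sup C) P x)) r,
    Finset.prod_mul_distrib, mul_mul_mul_comm, hconst, one_mul, avgChain]

/-- In the chain junction construction, the factorized
distribution `Q` exactly preserves every clique marginal of `P`:
`Q_{C_i} = P_{C_i}` for every `i`. -/
theorem chainQ_preserves_clique_marginals
    (P : (∀ i, F i) → ℝ) (hP : IsJoint P) (hfull : FullSupport P)
    (C : Fin (r + 1) → Finset ι)
    (hcov : Finset.univ.sup C = (Finset.univ : Finset ι))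
    (hsep : ∀ i : Fin (r + 1), i ≠ 0 → sepSet C i ⊆ C (i - 1))
    (hdisj : ∀ i j : Fin (r + 1), i ≠ j →
      Disjoint (if i = 0 then C 0 else resSet C i)
        (if j = 0 then C 0 else resSet C j)) :
    ∀ i : Fin (r + 1), marginal (chainQ P C) (C i) = marginal P (C i) := by
  obtain ⟨D, rfl⟩ : ∃ D : ℕ → Finset ι, C = fun j : Fin (r + 1) => D j :=
    ⟨fun n => C (Fin.ofNat (r + 1) n), by simp⟩
  have hcov' : (Finset.range (r + 1)).sup D = Finset.univ := by
    refine Finset.univ_subset_iff.1 (hcov ▸ Finset.sup_le fun j _ => ?_)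
    exact Finset.le_sup (f := D) (Finset.mem_range.2 j.2)
  have hsep' : ∀ i < r, D (i + 1) ∩ (Finset.range (i + 1)).sup D ⊆ D i := by
    intro i hi
    have h := hsep (Fin.succ ⟨i, hi⟩) (Fin.succ_ne_zero _)
    have hval : ((Fin.succ ⟨i, hi⟩ - 1 : Fin (r + 1)) : ℕ) = i := by
      rw [Fin.val_sub_one_of_ne_zero (Fin.succ_ne_zero _)]
      simp
    simpa only [sepSet, prevUnion_eq_sup_range, hval, Fin.val_succ] using h
  intro i
  funext s
  obtain ⟨x, rfl⟩ : ∃ x, restrict (D i) x = s :=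
    ⟨fun a => if h : a ∈ D i then s ⟨a, h⟩ else Classical.arbitrary _,
      funext fun a => by simp [restrict]⟩
  rw [marginal_restrict, marginal_restrict, chainQ_eq_avgChain P D hcov',
    avg_avgChain hfull D r hsep' i (Nat.le_of_lt_succ i.2)]

end CausalPre
end
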